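/- arXiv:2109.15011 — 2 statements merged into one kernel-verified Lean document; each statement's English description precedes it below -/
import Mathlib

section
/- (Necessity, case p = 1, 0 < q < 1.) Let 0 < q < 1 and let v, w be weights on (0,∞). If the two-weight Hardy inequality with p = 1 holds with a positive constant C for every nonnegative measurable function f on (0,∞), then ∫_0^∞ V(t)^{q/(1−q)} W(t)^{q/(1−q)} w(t) dt ≤ c·C^{q/(1−q)} < ∞, where V(t) = ess sup_{s∈(0,t)} 1/v(s) and c depends only on q. -/
open MeasureTheory Set ENNReal

/-- The essential supremum of `1 / v` over `(0, t)`. -/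
noncomputable def runningEssSup (v : ℝ → ℝ≥0∞) (t : ℝ) : ℝ≥0∞ :=
  essSup (fun s => (v s)⁻¹) (volume.restrict (Ioo (0 : ℝ) t))

theorem lt_runningEssSup_iff {v : ℝ → ℝ≥0∞} (hv : Measurable v) {x : ℝ≥0∞} {t : ℝ} :
    x < runningEssSup v t ↔ volume ({s | x < (v s)⁻¹} ∩ Ioo 0 t) ≠ 0 := by
  have hm : MeasurableSet {s | x < (v s)⁻¹} := measurableSet_lt measurable_const hv.inv
  have key : runningEssSup v t ≤ x ↔ volume.restrict (Ioo 0 t) {s | x < (v s)⁻¹} = 0 := by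
    constructor
    · intro h
      have := ENNReal.ae_le_essSup (μ := volume.restrict (Ioo (0 : ℝ) t)) (fun s => (v s)⁻¹)
      have h2 : ∀ᵐ s ∂(volume.restrict (Ioo (0 : ℝ) t)), (v s)⁻¹ ≤ x :=
        this.mono fun s hs => hs.trans h
      rw [ae_iff] at h2
      simpa only [not_le] using h2
    · intro h
      refine essSup_le_of_ae_le _ ?_
      rw [Filter.EventuallyLE, ae_iff]
      simpa only [not_le] using h
  rw [← Measure.restrict_apply hm, ← not_le, key]

theorem monotone_runningEssSup (v : ℝ → ℝ≥0∞) : Monotone (runningEssSup v) := fun _ _ h =>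
  essSup_mono_measure' (Measure.restrict_mono (Ioo_subset_Ioo_right h) le_rfl)

theorem pos_of_lt_runningEssSup {v : ℝ → ℝ≥0∞} (hv : Measurable v) {x : ℝ≥0∞} {t : ℝ}
    (h : x < runningEssSup v t) : 0 < t := by
  by_contra! ht
  rw [lt_runningEssSup_iff hv, Ioo_eq_empty (by simpa using ht)] at h
  simp at h

/-- Left-continuity of the running essential supremum. -/
theorem exists_lt_runningEssSup_sub {v : ℝ → ℝ≥0∞} (hv : Measurable v) {x : ℝ≥0∞} {t : ℝ}
    (h : x < runningEssSup v t) : ∃ j : ℕ, x < runningEssSup v (t - 1 / ((j : ℝ) + 1)) := by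
  by_contra! hj
  have hj' : ∀ j : ℕ, volume ({s | x < (v s)⁻¹} ∩ Ioo 0 (t - 1 / ((j : ℝ) + 1))) = 0 := by
    intro j
    have := (lt_runningEssSup_iff hv).not.1 (hj j).not_gt
    simpa using this
  rw [lt_runningEssSup_iff hv] at h
  refine h (measure_mono_null ?_ (measure_iUnion_null hj'))
  rintro s ⟨hs, hs0, hst⟩
  obtain ⟨j, hj⟩ := exists_nat_one_div_lt (sub_pos.2 hst)
  exact mem_iUnion.2 ⟨j, hs, hs0, by linarith⟩

/-- A function of unit mass, concentrated just to the right of the point where the running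
essential supremum exceeds `x`, on a set where `v ≤ 1 / x`. -/
theorem exists_unit_mass {v : ℝ → ℝ≥0∞} (hv : Measurable v) (x : ℝ≥0∞) {ε : ℝ} (hε : 0 < ε) :
    ∃ g : ℝ → ℝ≥0∞, Measurable g ∧
      (∀ t, x < runningEssSup v (t - ε) → 1 ≤ ∫⁻ s in Ioo 0 t, g s) ∧
      ∫⁻ s in Ioi (0 : ℝ), g s * v s ≤ x⁻¹ := by
  rcases ({t | x < runningEssSup v t}).eq_empty_or_nonempty with hT | hT
  · refine ⟨0, measurable_zero, fun t ht => ?_, by simp⟩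
    exact absurd ht (fun h => (hT ▸ h : t - ε ∈ (∅ : Set ℝ)))
  have hbdd : BddBelow {t | x < runningEssSup v t} :=
    ⟨0, fun t ht => (pos_of_lt_runningEssSup hv ht).le⟩
  obtain ⟨u, hu, hlt⟩ := exists_lt_of_csInf_lt hT (lt_add_of_pos_right _ hε)
  set A := {s | x < (v s)⁻¹} ∩ Ioo 0 u with hA
  have hAm : MeasurableSet A :=
    (measurableSet_lt measurable_const hv.inv).inter measurableSet_Ioo
  have hA0 : volume A ≠ 0 := (lt_runningEssSup_iff hv).1 hu
  have hAtop : volume A ≠ ∞ :=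
    ne_top_of_le_ne_top (by simp) (measure_mono (inter_subset_right : A ⊆ Ioo 0 u))
  refine ⟨A.indicator fun _ => (volume A)⁻¹, measurable_const.indicator hAm, fun t ht => ?_, ?_⟩
  · have hut : u ≤ t := by
      have := csInf_le hbdd (show t - ε ∈ _ from ht)
      linarith
    have hsub : A ⊆ Ioo 0 t := inter_subset_right.trans (Ioo_subset_Ioo_right hut)
    rw [lintegral_indicator_const hAm, Measure.restrict_apply hAm, inter_eq_left.2 hsub,
      ENNReal.inv_mul_cancel hA0 hAtop]
  · calc ∫⁻ s in Ioi (0 : ℝ), A.indicator (fun _ => (volume A)⁻¹) s * v s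
        ≤ ∫⁻ s, A.indicator (fun _ => (volume A)⁻¹) s * v s := setLIntegral_le_lintegral _ _
      _ ≤ ∫⁻ s, A.indicator (fun _ => (volume A)⁻¹ * x⁻¹) s := by
          refine lintegral_mono fun s => ?_
          by_cases hs : s ∈ A
          · simp only [indicator_of_mem hs]
            gcongr
            exact ENNReal.le_inv_iff_le_inv.1 (le_of_lt hs.1)
          · simp [indicator_of_notMem hs]
      _ = x⁻¹ := by
          rw [lintegral_indicator_const hAm, mul_right_comm, ENNReal.inv_mul_cancel hA0 hAtop,
            one_mul]

/-- The Hardy inequality tested against sums of approximate point masses. -/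
theorem lintegral_sum_indicator_rpow_le {q C : ℝ} (hq0 : 0 < q) {v w : ℝ → ℝ≥0∞}
    (hv : Measurable v) (hw : Measurable w)
    (H : ∀ f : ℝ → ℝ≥0∞, Measurable f →
      (∫⁻ t in Ioi (0 : ℝ), (∫⁻ s in Ioo 0 t, f s) ^ q * w t) ^ (1 / q) ≤
        ENNReal.ofReal C * ∫⁻ s in Ioi (0 : ℝ), f s * v s)
    {ι : Type*} (s : Finset ι) (x m : ι → ℝ≥0∞) :
    ∫⁻ t in Ioi (0 : ℝ), (∑ k ∈ s, {t | x k < runningEssSup v t}.indicator (fun _ => m k) t) ^ q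
        * w t ≤ (ENNReal.ofReal C * ∑ k ∈ s, m k * (x k)⁻¹) ^ q := by
  have hVm : Measurable (runningEssSup v) := (monotone_runningEssSup v).measurable
  have hε : ∀ j : ℕ, (0 : ℝ) < 1 / ((j : ℝ) + 1) := fun j => Nat.one_div_pos_of_nat
  choose g hgm hg1 hg2 using fun (j : ℕ) (k : ι) => exists_unit_mass hv (x k) (hε j)
  let S : ℕ → ι → Set ℝ := fun j k => {t | x k < runningEssSup v (t - 1 / ((j : ℝ) + 1))}
  have hSm : ∀ j k, MeasurableSet (S j k) := fun j k =>
    measurableSet_lt measurable_const (hVm.comp (measurable_id.sub_const _))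
  have hbound : ∀ j : ℕ, ∫⁻ t in Ioi (0 : ℝ),
      (∑ k ∈ s, (S j k).indicator (fun _ => m k) t) ^ q * w t ≤
        (ENNReal.ofReal C * ∑ k ∈ s, m k * (x k)⁻¹) ^ q := by
    intro j
    have hf : Measurable fun u => ∑ k ∈ s, m k * g j k u :=
      Finset.measurable_sum _ fun k _ => (hgm j k).const_mul _
    have h1 := H _ hf
    rw [one_div, ENNReal.rpow_inv_le_iff hq0] at h1
    refine (lintegral_mono fun t => ?_).trans (h1.trans ?_)
    · gcongr
      rw [lintegral_finsetSum _ fun k _ => (hgm j k).const_mul _]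
      refine Finset.sum_le_sum fun k _ => ?_
      rw [lintegral_const_mul _ (hgm j k)]
      by_cases ht : t ∈ S j k
      · rw [indicator_of_mem ht]
        exact le_mul_of_one_le_right' (hg1 j k t ht)
      · simp [indicator_of_notMem ht]
    · gcongr
      simp only [Finset.sum_mul, mul_assoc]
      have hgv : ∀ k, Measurable fun u => g j k u * v u := fun k => (hgm j k).mul hv
      rw [lintegral_finsetSum _ fun k _ => (hgv k).const_mul _]
      refine Finset.sum_le_sum fun k _ => ?_
      rw [lintegral_const_mul _ (hgv k)]
      gcongr
      exact hg2 j k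
  have hSmono : ∀ k, Monotone fun j => S j k := by
    intro k i j hij t ht
    refine lt_of_lt_of_le (show x k < _ from ht) (monotone_runningEssSup v ?_)
    have := one_div_le_one_div_of_le (show (0 : ℝ) < i + 1 by positivity)
      (show (i : ℝ) + 1 ≤ j + 1 by gcongr)
    linarith
  refine le_of_tendsto' (lintegral_tendsto_of_tendsto_of_monotone (fun j => ?_) ?_ ?_) hbound
  · exact (((Finset.measurable_sum _ fun k _ =>
      measurable_const.indicator (hSm j k)).pow_const q).mul hw).aemeasurable
  · refine Filter.Eventually.of_forall fun t i j hij => ?_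
    dsimp only
    gcongr with k hk
    exact hSmono k hij
  · refine Filter.Eventually.of_forall fun t => tendsto_const_nhds.congr' ?_
    have hev : ∀ k ∈ s, ∀ᶠ j in Filter.atTop, {t | x k < runningEssSup v t}.indicator
        (fun _ => m k) t = (S j k).indicator (fun _ => m k) t := by
      intro k _
      by_cases ht : x k < runningEssSup v t
      · obtain ⟨i, hi⟩ := exists_lt_runningEssSup_sub hv ht
        filter_upwards [Filter.eventually_ge_atTop i] with j hj
        rw [indicator_of_mem (show t ∈ {t | x k < runningEssSup v t} from ht),
          indicator_of_mem (hSmono k hj hi)]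
      · refine Filter.Eventually.of_forall fun j => ?_
        rw [indicator_of_notMem (show t ∉ {t | x k < runningEssSup v t} from ht),
          indicator_of_notMem]
        intro h
        exact ht (lt_of_lt_of_le (show x k < _ from h)
          (monotone_runningEssSup v (sub_le_self _ (hε j).le)))
    filter_upwards [(Finset.eventually_all s).2 hev] with j hj
    rw [Finset.sum_congr rfl hj]

/-- The constant in `sum_le_of_sum_le_rpow_add`. -/
noncomputable def discreteConst (q : ℝ) : ℝ :=
  (((1 - q) * (1 - (1 / 2) ^ (q / (1 - q))))⁻¹) ^ (1 / (1 - q))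

theorem discreteConst_pos {q : ℝ} (hq0 : 0 < q) (hq1 : q < 1) : 0 < discreteConst q := by
  have h1 : 0 < 1 - q := by linarith
  have h2 : ((1 : ℝ) / 2) ^ (q / (1 - q)) < 1 :=
    Real.rpow_lt_one (by norm_num) (by norm_num) (by positivity)
  have h3 : 0 < 1 - ((1 : ℝ) / 2) ^ (q / (1 - q)) := by linarith
  unfold discreteConst
  positivity

theorem rpow_mul_le_young {q : ℝ} (hq0 : 0 < q) (hq1 : q < 1) {a b : ℝ} (ha : 0 ≤ a)
    (hb : 0 ≤ b) : a ^ (q / (1 - q)) * b ≤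
      q * (a ^ (q / (1 - q)) * a) + (1 - q) * (b ^ (q / (1 - q)) * b) := by
  have h1 : 0 < 1 - q := by linarith
  have key : ∀ {c : ℝ}, 0 ≤ c → c ^ (q / (1 - q)) * c = c ^ (1 / (1 - q)) := by
    intro c hc
    nth_rw 2 [← Real.rpow_one c]
    rw [← Real.rpow_add_of_nonneg hc (by positivity) zero_le_one]
    congr 1
    field_simp
    ring
  have h := Real.geom_mean_le_arith_mean2_weighted hq0.le h1.le
    (Real.rpow_nonneg ha (1 / (1 - q))) (Real.rpow_nonneg hb (1 / (1 - q))) (by ring)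
  rw [← Real.rpow_mul ha, ← Real.rpow_mul hb] at h
  rw [key ha, key hb]
  convert h using 2
  · congr 1; ring
  · rw [one_div, inv_mul_cancel₀ h1.ne', Real.rpow_one]

theorem le_of_mul_le_mul_rpow {q S D δ : ℝ} (hq1 : q < 1) (hS : 0 ≤ S) (hD : 0 ≤ D)
    (hδ : 0 < δ) (h : δ * S ≤ (D * S) ^ q) :
    S ≤ (δ⁻¹) ^ (1 / (1 - q)) * D ^ (q / (1 - q)) := by
  have h1 : 0 < 1 - q := by linarith
  rcases hS.eq_or_lt with rfl | hS
  · positivity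
  have h2 : S ^ (1 - q) ≤ δ⁻¹ * D ^ q := by
    rw [Real.mul_rpow hD hS.le] at h
    rw [Real.rpow_sub hS, Real.rpow_one, div_le_iff₀ (by positivity), mul_assoc,
      ← div_eq_inv_mul, le_div_iff₀ hδ]
    linarith
  have h3 := Real.rpow_le_rpow (by positivity) h2 (show 0 ≤ 1 / (1 - q) by positivity)
  rw [← Real.rpow_mul hS.le, mul_one_div_cancel h1.ne', Real.rpow_one,
    Real.mul_rpow (by positivity) (by positivity), ← Real.rpow_mul hD, mul_one_div] at h3
  exact h3

theorem sum_le_of_sum_le_rpow_add {q D : ℝ} (hq0 : 0 < q) (hq1 : q < 1) (hD : 0 ≤ D)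
    {x w : ℕ → ℝ} (hx : ∀ n, 0 ≤ x n) (hx2 : ∀ n, x (n + 1) = 2 * x n) (hw : ∀ n, 0 ≤ w n) (M : ℕ)
    (h : ∑ n ∈ Finset.range (M + 1), (x n * w n) ^ (q / (1 - q)) * w n ≤
      (D * ∑ n ∈ Finset.range (M + 1), (x n * w n) ^ (q / (1 - q)) * w n) ^ q +
        ∑ n ∈ Finset.range M, (x n * w n) ^ (q / (1 - q)) * w (n + 1)) :
    ∑ n ∈ Finset.range (M + 1), (x n * w n) ^ (q / (1 - q)) * w n ≤
      discreteConst q * D ^ (q / (1 - q)) := by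
  have h1 : 0 < 1 - q := by linarith
  have h2 : ((1 : ℝ) / 2) ^ (q / (1 - q)) < 1 :=
    Real.rpow_lt_one (by norm_num) (by norm_num) (by positivity)
  have h3 : 0 < 1 - ((1 : ℝ) / 2) ^ (q / (1 - q)) := by linarith
  set r := q / (1 - q) with hr
  let A : ℕ → ℝ := fun n => (x n * w n) ^ r * w n
  have hA : ∀ n, 0 ≤ A n := fun n =>
    mul_nonneg (Real.rpow_nonneg (mul_nonneg (hx n) (hw n)) _) (hw n)
  have hstep : ∀ n, (x n * w n) ^ r * w (n + 1) ≤
      q * A n + (1 - q) * (1 / 2) ^ r * A (n + 1) := by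
    intro n
    have hy := mul_le_mul_of_nonneg_left (rpow_mul_le_young hq0 hq1 (hw n) (hw (n + 1)))
      (Real.rpow_nonneg (hx n) r)
    have hxr : x n ^ r = (1 / 2) ^ r * x (n + 1) ^ r := by
      rw [← Real.mul_rpow (by norm_num) (hx _), hx2]
      congr 1; ring
    simp only [A]
    rw [Real.mul_rpow (hx _) (hw _), Real.mul_rpow (hx _) (hw _)]
    calc _ = x n ^ r * (w n ^ r * w (n + 1)) := by ring
      _ ≤ _ := hy
      _ = q * (x n ^ r * w n ^ r * w n) + (1 - q) * (w (n + 1) ^ r * w (n + 1)) * x n ^ r := by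
        rw [← hr]; ring
      _ = _ := by rw [hxr]; ring
  have hsum := Finset.sum_le_sum fun n (_ : n ∈ Finset.range M) => hstep n
  rw [Finset.sum_add_distrib, ← Finset.mul_sum, ← Finset.mul_sum] at hsum
  have hb1 : ∑ n ∈ Finset.range M, A n ≤ ∑ n ∈ Finset.range (M + 1), A n := by
    rw [Finset.sum_range_succ]; linarith [hA M]
  have hb2 : ∑ n ∈ Finset.range M, A (n + 1) ≤ ∑ n ∈ Finset.range (M + 1), A n := by
    rw [Finset.sum_range_succ']; linarith [hA 0]
  refine le_of_mul_le_mul_rpow hq1 (Finset.sum_nonneg fun n _ => hA n) hD (mul_pos h1 h3) ?_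
  have hb1' := mul_le_mul_of_nonneg_left hb1 hq0.le
  have hb2' := mul_le_mul_of_nonneg_left hb2 (show 0 ≤ (1 - q) * (1 / 2 : ℝ) ^ r by positivity)
  simp only [A] at *
  linarith

theorem sum_indicator_rpow_le {α : Type*} {q : ℝ} (hq0 : 0 < q) {B : ℕ → Set α}
    (hB : Antitone B) (p : ℕ → ℝ≥0∞) (M : ℕ) (t : α) :
    ∑ n ∈ Finset.range (M + 1), (B n).indicator (fun _ => p n ^ q) t ≤
      (∑ n ∈ Finset.range (M + 1), (B n).indicator (fun _ => p n) t) ^ q +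
        ∑ n ∈ Finset.range M, (B (n + 1)).indicator (fun _ => p n ^ q) t := by
  induction M with
  | zero =>
    by_cases ht : t ∈ B 0 <;> simp [ht]
  | succ M ih =>
    by_cases ht : t ∈ B (M + 1)
    · have hmem : ∀ n ≤ M + 1, t ∈ B n := fun n hn => hB hn ht
      rw [Finset.sum_range_succ _ (M + 1), add_comm]
      refine add_le_add ?_ (le_of_eq (Finset.sum_congr rfl fun n hn => ?_))
      · rw [indicator_of_mem ht]
        refine ENNReal.rpow_le_rpow ?_ hq0.le
        rw [Finset.sum_range_succ _ (M + 1), indicator_of_mem ht]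
        exact le_add_self
      · have hn' := Finset.mem_range.1 hn
        rw [indicator_of_mem (hmem n (by omega)), indicator_of_mem (hmem (n + 1) (by omega))]
    · simpa [Finset.sum_range_succ, ht] using ih

theorem sum_measure_le {α : Type*} [MeasurableSpace α] {μ : Measure α} {q D : ℝ} (hq0 : 0 < q)
    (hq1 : q < 1) (hD : 0 ≤ D) {B : ℕ → Set α} (hBm : ∀ n, MeasurableSet (B n))
    (hB : Antitone B) (hBtop : ∀ n, μ (B n) ≠ ∞)
    {x : ℕ → ℝ} (hx : ∀ n, 0 < x n) (hx2 : ∀ n, x (n + 1) = 2 * x n) (M : ℕ)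
    (H : ∀ p : ℕ → ℝ≥0∞,
      ∫⁻ t, (∑ n ∈ Finset.range (M + 1), (B n).indicator (fun _ => p n) t) ^ q ∂μ ≤
        (ENNReal.ofReal D * ∑ n ∈ Finset.range (M + 1), p n * (ENNReal.ofReal (x n))⁻¹) ^ q) :
    ∑ n ∈ Finset.range (M + 1), (ENNReal.ofReal (x n) * μ (B n)) ^ (q / (1 - q)) * μ (B n) ≤
      ENNReal.ofReal (discreteConst q * D ^ (q / (1 - q))) := by
  have h1 : 0 < 1 - q := by linarith
  have hr : 0 ≤ q / (1 - q) := by positivity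
  set r := q / (1 - q) with hrdef
  obtain ⟨w, hw, hwB⟩ : ∃ w : ℕ → ℝ, (∀ n, 0 ≤ w n) ∧ ∀ n, μ (B n) = ENNReal.ofReal (w n) :=
    ⟨fun n => (μ (B n)).toReal, fun n => toReal_nonneg, fun n => (ofReal_toReal (hBtop n)).symm⟩
  have hd : ∀ n, 0 ≤ x n * w n := fun n => mul_nonneg (hx n).le (hw n)
  let p : ℕ → ℝ≥0∞ := fun n => ENNReal.ofReal ((x n * w n) ^ (1 / (1 - q)))
  have hpq : ∀ n, p n ^ q = ENNReal.ofReal ((x n * w n) ^ r) := by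
    intro n
    rw [ENNReal.ofReal_rpow_of_nonneg (Real.rpow_nonneg (hd n) _) hq0.le, ← Real.rpow_mul (hd n),
      one_div_mul_eq_div]
  have hpx : ∀ n, p n * (ENNReal.ofReal (x n))⁻¹ = ENNReal.ofReal ((x n * w n) ^ r * w n) := by
    intro n
    rw [← ENNReal.ofReal_inv_of_pos (hx n),
      ← ENNReal.ofReal_mul (Real.rpow_nonneg (hd n) _)]
    have : 1 / (1 - q) = r + 1 := by rw [hrdef]; field_simp; ring
    rw [this, Real.rpow_add_of_nonneg (hd n) hr zero_le_one, Real.rpow_one]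
    congr 1
    have := (hx n).ne'
    field_simp
  have hint : ∀ (n : ℕ) (c : ℝ≥0∞), ∫⁻ t, (B n).indicator (fun _ => c) t ∂μ = c * μ (B n) :=
    fun n c => lintegral_indicator_const (hBm n) c
  have hmain := (lintegral_mono (μ := μ) fun t => sum_indicator_rpow_le hq0 hB p M t).trans_eq
    (lintegral_add_right _ (Finset.measurable_sum _ fun n _ =>
      measurable_const.indicator (hBm (n + 1))))
  rw [lintegral_finsetSum _ fun n _ => measurable_const.indicator (hBm n),
    lintegral_finsetSum _ fun n _ => measurable_const.indicator (hBm (n + 1))] at hmain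
  replace hmain := hmain.trans (add_le_add_left (H p) _)
  have hA : ∀ n, 0 ≤ (x n * w n) ^ r * w n := fun n =>
    mul_nonneg (Real.rpow_nonneg (hd n) _) (hw n)
  have hA' : ∀ n, 0 ≤ (x n * w n) ^ r * w (n + 1) := fun n =>
    mul_nonneg (Real.rpow_nonneg (hd n) _) (hw _)
  simp only [hint, hpq, hpx, hwB] at hmain
  simp only [← ENNReal.ofReal_mul (Real.rpow_nonneg (hd _) _)] at hmain
  rw [← ENNReal.ofReal_sum_of_nonneg fun n _ => hA n,
    ← ENNReal.ofReal_sum_of_nonneg fun n _ => hA' n, ← ENNReal.ofReal_mul hD,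
    ENNReal.ofReal_rpow_of_nonneg (mul_nonneg hD (Finset.sum_nonneg fun n _ => hA n)) hq0.le,
    ← ENNReal.ofReal_add (Real.rpow_nonneg (mul_nonneg hD (Finset.sum_nonneg fun n _ => hA n)) _)
      (Finset.sum_nonneg fun n _ => hA' n),
    ENNReal.ofReal_le_ofReal_iff (add_nonneg
      (Real.rpow_nonneg (mul_nonneg hD (Finset.sum_nonneg fun n _ => hA n)) _)
      (Finset.sum_nonneg fun n _ => hA' n))] at hmain
  have hfin := sum_le_of_sum_le_rpow_add hq0 hq1 hD (fun n => (hx n).le) hx2 hw M hmain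
  refine le_trans (le_of_eq ?_) (ENNReal.ofReal_le_ofReal hfin)
  rw [ENNReal.ofReal_sum_of_nonneg fun n _ => hA n]
  refine Finset.sum_congr rfl fun n _ => ?_
  rw [hwB, ← ENNReal.ofReal_mul (hx n).le, ENNReal.ofReal_rpow_of_nonneg (hd n) hr,
    ← ENNReal.ofReal_mul (Real.rpow_nonneg (hd n) _)]


theorem tsum_int_le_of_sum_range_le {F : ℤ → ℝ≥0∞} {K : ℝ≥0∞}
    (h : ∀ (a : ℤ) (M : ℕ), ∑ n ∈ Finset.range (M + 1), F (a + n) ≤ K) : ∑' k, F k ≤ K := by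
  refine ENNReal.summable.tsum_le_of_sum_le fun s => ?_
  rcases s.eq_empty_or_nonempty with rfl | hs
  · simp
  have hsub : s ⊆ (Finset.range ((s.max' hs - s.min' hs).toNat + 1)).image
      (fun n : ℕ => s.min' hs + n) := by
    intro k hk
    have h1 := s.min'_le k hk
    have h2 := s.le_max' k hk
    exact Finset.mem_image.2 ⟨(k - s.min' hs).toNat, Finset.mem_range.2 (by omega), by omega⟩
  refine (Finset.sum_le_sum_of_subset hsub).trans ?_
  rw [Finset.sum_image fun i _ j _ hij => by simpa using hij]
  exact h _ _

/-- Necessity, case `p = 1`, `0 < q < 1`: if the two-weight Hardy inequality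
with `p = 1` holds with positive constant `C`, then
`∫_0^∞ V(t)^{q/(1-q)} W(t)^{q/(1-q)} w(t) dt ≤ c·C^{q/(1-q)} < ∞`, where
`V(t) = ess sup_{s∈(0,t)} 1/v(s)` and `c` depends only on `q`. -/
theorem hardy_necessity_nonconvex_p_eq_one (q : ℝ) (hq0 : 0 < q) (hq1 : q < 1) :
    ∃ c : ℝ, 0 < c ∧
      ∀ (v w : ℝ → ℝ≥0∞), Measurable v → Measurable w →
      ∀ C : ℝ, 0 < C →
      (∀ f : ℝ → ℝ≥0∞, Measurable f →
        (∫⁻ t in Ioi (0 : ℝ), (∫⁻ s in Ioo 0 t, f s) ^ q * w t) ^ (1 / q) ≤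
          ENNReal.ofReal C * ∫⁻ s in Ioi (0 : ℝ), f s * v s) →
      (∫⁻ t in Ioi (0 : ℝ),
          (essSup (fun s => (v s)⁻¹) (volume.restrict (Ioo (0 : ℝ) t))) ^ (q / (1 - q)) *
            (∫⁻ s in Ioi t, w s) ^ (q / (1 - q)) * w t) ≤
        ENNReal.ofReal (c * C ^ (q / (1 - q))) := by
  have h1 : 0 < 1 - q := by linarith
  set r := q / (1 - q) with hrdef
  have hr : 0 < r := by positivity
  refine ⟨2 ^ r * discreteConst q, mul_pos (by positivity) (discreteConst_pos hq0 hq1), ?_⟩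
  intro v w hv hw C hC H
  let V := runningEssSup v
  have hVm : Measurable V := (monotone_runningEssSup v).measurable
  let μ := (volume.restrict (Ioi (0 : ℝ))).withDensity w
  have hμ : ∀ f : ℝ → ℝ≥0∞, Measurable f →
      ∫⁻ t, f t ∂μ = ∫⁻ t in Ioi (0 : ℝ), f t * w t := by
    intro f hf
    rw [lintegral_withDensity_eq_lintegral_mul _ hw hf]
    simp only [Pi.mul_apply, mul_comm]
  let x : ℤ → ℝ≥0∞ := fun k => ENNReal.ofReal ((2 : ℝ) ^ k)
  have hx2 : ∀ k, x k = (2 : ℝ≥0∞) ^ k := by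
    intro k
    rw [← ENNReal.ofReal_ofNat 2, ← ENNReal.rpow_intCast,
      ENNReal.ofReal_rpow_of_pos two_pos, Real.rpow_intCast]
  let E : ℤ → Set ℝ := fun k => {t | x k < V t}
  have hEm : ∀ k, MeasurableSet (E k) := fun k => measurableSet_lt measurable_const hVm
  have hE : Antitone E := fun i j hij t ht =>
    lt_of_le_of_lt (ENNReal.ofReal_le_ofReal (zpow_le_zpow_right₀ one_le_two hij)) ht
  have hA : ∀ (e : ℕ → ℤ) (s : Finset ℕ) (p : ℕ → ℝ≥0∞),
      ∫⁻ t, (∑ n ∈ s, (E (e n)).indicator (fun _ => p n) t) ^ q ∂μ ≤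
        (ENNReal.ofReal C * ∑ n ∈ s, p n * (x (e n))⁻¹) ^ q := by
    intro e s p
    rw [hμ _ ((Finset.measurable_sum _ fun n _ =>
      measurable_const.indicator (hEm (e n))).pow_const q)]
    exact lintegral_sum_indicator_rpow_le hq0 hv hw H s (fun n => x (e n)) p
  have hEle : ∀ k, μ (E k) ≤ (ENNReal.ofReal C * (x k)⁻¹) ^ q := by
    intro k
    have h := hA (fun _ => k) {0} 1
    simp only [Finset.sum_singleton, Pi.one_apply, one_mul] at h
    refine le_trans (le_of_eq ?_) h
    rw [← lintegral_indicator_one (hEm k)]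
    refine lintegral_congr fun t => ?_
    by_cases ht : t ∈ E k <;> simp [ht, hq0]
  have hxinv : ∀ k, (x k)⁻¹ = ENNReal.ofReal (((2 : ℝ) ^ k)⁻¹) := fun k =>
    (ENNReal.ofReal_inv_of_pos (by positivity)).symm
  have hEtop : ∀ k, μ (E k) ≠ ∞ := by
    intro k
    refine ne_top_of_le_ne_top (ENNReal.rpow_ne_top_of_nonneg hq0.le ?_) (hEle k)
    rw [hxinv]
    exact ENNReal.mul_ne_top ofReal_ne_top ofReal_ne_top
  have hsum : ∑' k, (x k * μ (E k)) ^ r * μ (E k) ≤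
      ENNReal.ofReal (discreteConst q * C ^ r) := by
    refine tsum_int_le_of_sum_range_le fun a M => ?_
    refine sum_measure_le hq0 hq1 hC.le (B := fun n : ℕ => E (a + n))
      (x := fun n : ℕ => (2 : ℝ) ^ (a + n)) (fun n => hEm _) (fun i j hij => hE (by simpa using hij))
      (fun n => hEtop _) (fun n => by positivity) (fun n => ?_) M
      (fun p => hA (fun n => a + n) _ p)
    push_cast
    rw [← add_assoc, zpow_add_one₀ two_ne_zero, mul_comm]
  have hW : ∀ t, 0 < t → ∀ k, x k < V t → ∫⁻ s in Ioi t, w s ≤ μ (E k) := by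
    intro t ht k hk
    have hsub : Ioi t ⊆ E k := fun s hs => hk.trans_le (monotone_runningEssSup v (le_of_lt hs))
    refine le_trans (le_of_eq ?_) (measure_mono hsub)
    rw [withDensity_apply _ measurableSet_Ioi, Measure.restrict_restrict measurableSet_Ioi,
      inter_eq_left.2 (Ioi_subset_Ioi ht.le)]
  have hpt : ∀ t, 0 < t → V t ^ r * (∫⁻ s in Ioi t, w s) ^ r ≤
      2 ^ r * ∑' k, (E k).indicator (fun _ => (x k * μ (E k)) ^ r) t := by
    intro t ht
    rcases eq_or_ne (V t) 0 with h0 | h0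
    · simp [h0, hr]
    rcases eq_or_ne (V t) ∞ with htop | htop
    · have hlim : Filter.Tendsto (fun n : ℕ => (ENNReal.ofReal C * (x n)⁻¹) ^ q) Filter.atTop
          (nhds 0) := by
        have h2 : Filter.Tendsto (fun n : ℕ => C * ((2 : ℝ) ^ (n : ℤ))⁻¹) Filter.atTop
            (nhds (C * 0)) := by
          refine Filter.Tendsto.const_mul _ ?_
          simp only [zpow_natCast, ← inv_pow]
          exact tendsto_pow_atTop_nhds_zero_of_lt_one (by norm_num) (by norm_num)
        have h3 := ((ENNReal.continuous_rpow_const (y := q)).tendsto _).comp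
          (ENNReal.tendsto_ofReal h2)
        simp only [mul_zero, ENNReal.ofReal_zero, ENNReal.zero_rpow_of_pos hq0] at h3
        refine h3.congr fun n => ?_
        simp only [Function.comp_apply, hxinv, ENNReal.ofReal_mul hC.le]
      have hW0 : ∫⁻ s in Ioi t, w s = 0 := le_antisymm
        (ge_of_tendsto' hlim fun n => (hW t ht n (htop ▸ ofReal_lt_top)).trans (hEle n)) zero_le
      simp [hW0, hr]
    obtain ⟨k, hk1, hk2⟩ := ENNReal.exists_mem_Ioc_zpow h0 htop one_lt_two ofNat_ne_top
    rw [← hx2] at hk1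
    have hk2' : V t ≤ 2 * x k := by
      refine hk2.trans_eq ?_
      rw [hx2, ENNReal.zpow_add two_ne_zero ofNat_ne_top, zpow_one, mul_comm]
    calc V t ^ r * (∫⁻ s in Ioi t, w s) ^ r ≤ (2 * x k) ^ r * μ (E k) ^ r := by
          gcongr
          exact hW t ht k hk1
      _ = 2 ^ r * (E k).indicator (fun _ => (x k * μ (E k)) ^ r) t := by
          rw [indicator_of_mem (show t ∈ E k from hk1), ← ENNReal.mul_rpow_of_nonneg _ _ hr.le,
            mul_assoc, ENNReal.mul_rpow_of_nonneg _ _ hr.le]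
      _ ≤ _ := by
          gcongr
          exact ENNReal.le_tsum k
  have hindm : ∀ k, Measurable fun t => (E k).indicator (fun _ => (x k * μ (E k)) ^ r) t :=
    fun k => measurable_const.indicator (hEm k)
  have htsm : Measurable fun t => ∑' k, (E k).indicator (fun _ => (x k * μ (E k)) ^ r) t :=
    Measurable.tsum hindm
  calc _ ≤ ∫⁻ t in Ioi (0 : ℝ),
        2 ^ r * (∑' k, (E k).indicator (fun _ => (x k * μ (E k)) ^ r) t) * w t :=
        setLIntegral_mono' measurableSet_Ioi fun t ht => mul_le_mul_left (hpt t ht) _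
    _ = 2 ^ r * ∑' k, (x k * μ (E k)) ^ r * μ (E k) := by
        rw [← hμ _ (htsm.const_mul _), lintegral_const_mul _ htsm,
          lintegral_tsum fun k => (hindm k).aemeasurable]
        simp only [lintegral_indicator_const (hEm _)]
    _ ≤ 2 ^ r * ENNReal.ofReal (discreteConst q * C ^ r) := by gcongr
    _ = ENNReal.ofReal (2 ^ r * discreteConst q * C ^ r) := by
        rw [mul_assoc, ENNReal.ofReal_mul (by positivity : (0 : ℝ) ≤ 2 ^ r),
          ← ENNReal.ofReal_rpow_of_nonneg zero_le_two hr.le]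
        simp
end

section
/- (Test function: upper bound, necessity for p > q, p > 1.) Let 1 < p < ∞, 0 < q < p, r = pq/(p−q), let v, w be weights on (0,∞), let θ ∈ (r/p', ∞), set B = ∫_0^∞ V^r W^{r/p} w, and define f(t) = (∫_t^∞ W(s)^{r/p} w(s) V(s)^{r−θp'} ds)^{1/p} · V(t)^{(θ−1)(p'−1)} · v(t)^{1−p'} for t ∈ (0,∞). Then ∫_0^∞ f(t)^p v(t) dt ≤ c·B, where c depends only on p, q and θ. -/
open MeasureTheory Set ENNReal

/-- For an atomless measure, the set of points `t` at which the distribution function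
`t ↦ μ (0,t)` is at most `x` has measure at most `x`. -/
lemma measure_setOf_measure_Ioo_le (μ : Measure ℝ) [NullSingletonClass μ] (s : ℝ) (x : ℝ≥0∞) :
    μ {t | t ∈ Ioo 0 s ∧ μ (Ioo 0 t) ≤ x} ≤ x := by
  set A := {t | t ∈ Ioo 0 s ∧ μ (Ioo 0 t) ≤ x}
  rcases A.eq_empty_or_nonempty with h | h
  · simp [h]
  have hbdd : BddAbove A := ⟨s, fun t ht => ht.1.2.le⟩
  obtain ⟨u, hu, hlim, hmem⟩ := exists_seq_tendsto_sSup h hbdd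
  calc μ A ≤ μ (Ioc 0 (sSup A)) :=
        measure_mono fun t ht => ⟨ht.1.1, le_csSup hbdd ht⟩
    _ = μ (Ioo 0 (sSup A)) := measure_congr Ioo_ae_eq_Ioc.symm
    _ ≤ μ (⋃ n, Ioo 0 (u n)) := by
        refine measure_mono fun t ht => ?_
        obtain ⟨n, hn⟩ := (hlim.eventually (lt_mem_nhds ht.2)).exists
        exact mem_iUnion.2 ⟨n, ht.1, hn⟩
    _ = ⨆ n, μ (Ioo 0 (u n)) :=
        Monotone.measure_iUnion fun m n hmn => Ioo_subset_Ioo_right (hu hmn)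
    _ ≤ x := iSup_le fun n => (hmem n).2

lemma measurable_measure_Ioo (μ : Measure ℝ) : Measurable fun t : ℝ => μ (Ioo 0 t) :=
  Monotone.measurable fun _ _ h => measure_mono (Ioo_subset_Ioo_right h)

/-- A point of `(0, M]` lies in one of the dyadic intervals `(M / 2 ^ (k + 1), M / 2 ^ k]`. -/
lemma ENNReal.exists_dyadic_near {x M : ℝ≥0∞} (hx : x ≠ 0) (hxM : x ≤ M) (hM : M ≠ ⊤) :
    ∃ k : ℕ, M * 2⁻¹ ^ (k + 1) ≤ x ∧ x ≤ M * 2⁻¹ ^ k := by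
  lift M to NNReal using hM
  lift x to NNReal using ne_top_of_le_ne_top coe_ne_top hxM
  have hx0 : 0 < x := pos_iff_ne_zero.2 (by exact_mod_cast hx)
  have hxM' : x ≤ M := by exact_mod_cast hxM
  have hM0 : 0 < M := hx0.trans_le hxM'
  obtain ⟨k, h1, h2⟩ := exists_nat_pow_near_of_lt_one (x := x / M) (y := (2⁻¹ : NNReal))
    (by positivity) ((div_le_one hM0).2 hxM') (by positivity) (by norm_num)
  rw [lt_div_iff₀ hM0] at h1
  rw [div_le_iff₀ hM0] at h2
  have h2' : ((2⁻¹ : NNReal) : ℝ≥0∞) = 2⁻¹ := by simp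
  refine ⟨k, ?_, ?_⟩ <;> rw [← h2'] <;> norm_cast
  · rw [mul_comm]; exact h1.le
  · rw [mul_comm]; exact h2

/-- The estimate `∫_0^s U^{θ-1} dU ≤ C U(s)^θ` for the distribution function `U` of an
atomless measure. -/
lemma exists_lintegral_measure_Ioo_rpow_le (θ : ℝ) (hθ : 0 < θ) :
    ∃ C : ℝ≥0∞, C ≠ ⊤ ∧ ∀ (μ : Measure ℝ) [NullSingletonClass μ] (s : ℝ), μ (Ioo 0 s) ≠ ⊤ →
      ∫⁻ t in Ioo 0 s, μ (Ioo 0 t) ^ (θ - 1) ∂μ ≤ C * μ (Ioo 0 s) ^ θ := by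
  rcases le_or_gt 1 θ with h1 | h1
  · refine ⟨1, one_ne_top, fun μ _ s hs => ?_⟩
    calc ∫⁻ t in Ioo 0 s, μ (Ioo 0 t) ^ (θ - 1) ∂μ
        ≤ ∫⁻ _ in Ioo 0 s, μ (Ioo 0 s) ^ (θ - 1) ∂μ :=
          setLIntegral_mono measurable_const fun t ht =>
            ENNReal.rpow_le_rpow (measure_mono (Ioo_subset_Ioo_right ht.2.le)) (by linarith)
      _ = μ (Ioo 0 s) ^ (θ - 1) * μ (Ioo 0 s) ^ (1 : ℝ) := by simp
      _ = 1 * μ (Ioo 0 s) ^ θ := by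
          rw [← ENNReal.rpow_add_of_nonneg _ _ (by linarith) zero_le_one, one_mul]; congr 1; ring
  have hlt : (2⁻¹ : ℝ≥0∞) ^ θ < 1 := ENNReal.rpow_lt_one (by norm_num) hθ
  refine ⟨2⁻¹ ^ (θ - 1) * (1 - 2⁻¹ ^ θ)⁻¹, ?_, fun μ _ s hs => ?_⟩
  · refine ENNReal.mul_ne_top (ENNReal.rpow_ne_top_of_ne_zero (by simp) (by simp)) ?_
    exact ENNReal.inv_ne_top.2 (tsub_pos_of_lt hlt).ne'
  set M := μ (Ioo 0 s)
  by_cases hM : M = 0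
  · rw [Measure.restrict_eq_zero.2 hM]; simp
  have hnull : ∀ᵐ t ∂μ.restrict (Ioo 0 s), μ (Ioo 0 t) ≠ 0 := by
    rw [ae_restrict_iff' measurableSet_Ioo, ae_iff]
    refine le_antisymm (le_trans (measure_mono ?_) (measure_setOf_measure_Ioo_le μ s 0)) zero_le
    intro t ht
    simp only [mem_ofPred_eq, Classical.not_imp, not_not] at ht
    exact ⟨ht.1, ht.2.le⟩
  have hmeas : ∀ k : ℕ, MeasurableSet {t | μ (Ioo 0 t) ≤ M * 2⁻¹ ^ k} := fun k =>
    measurableSet_le (measurable_measure_Ioo μ) measurable_const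
  have hterm (k : ℕ) : (M * 2⁻¹ ^ (k + 1)) ^ (θ - 1) * (M * 2⁻¹ ^ k)
      = 2⁻¹ ^ (θ - 1) * M ^ θ * (2⁻¹ ^ θ) ^ k := by
    have hk : (2⁻¹ : ℝ≥0∞) ^ k ≠ 0 := pow_ne_zero _ (by simp)
    have hk' : (2⁻¹ : ℝ≥0∞) ^ k ≠ ⊤ := ENNReal.pow_ne_top (by simp)
    have hy0 : M * 2⁻¹ ^ k ≠ 0 := mul_ne_zero hM hk
    have hyt : M * 2⁻¹ ^ k ≠ ⊤ := ENNReal.mul_ne_top hs hk'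
    have hsucc : M * (2⁻¹ : ℝ≥0∞) ^ (k + 1) = M * 2⁻¹ ^ k * 2⁻¹ := by rw [pow_succ, mul_assoc]
    rw [hsucc, ENNReal.mul_rpow_of_ne_top hyt (by simp), mul_comm (_ ^ (θ - 1)), mul_assoc]
    nth_rewrite 2 [← ENNReal.rpow_one (M * 2⁻¹ ^ k)]
    rw [← ENNReal.rpow_add _ _ hy0 hyt, sub_add_cancel, ENNReal.mul_rpow_of_ne_top hs hk',
      ← ENNReal.rpow_natCast, ← ENNReal.rpow_natCast, ← ENNReal.rpow_mul, ← ENNReal.rpow_mul,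
      mul_comm (k : ℝ), mul_assoc]
  calc ∫⁻ t in Ioo 0 s, μ (Ioo 0 t) ^ (θ - 1) ∂μ
      ≤ ∫⁻ t in Ioo 0 s, ∑' k : ℕ, {t | μ (Ioo 0 t) ≤ M * 2⁻¹ ^ k}.indicator
          (fun _ => (M * 2⁻¹ ^ (k + 1)) ^ (θ - 1)) t ∂μ := by
        refine lintegral_mono_ae ?_
        filter_upwards [hnull, ae_restrict_mem measurableSet_Ioo] with t ht hts
        obtain ⟨k, hk1, hk2⟩ := ENNReal.exists_dyadic_near ht
          (measure_mono (Ioo_subset_Ioo_right hts.2.le)) hs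
        refine le_trans ?_ (ENNReal.le_tsum k)
        rw [indicator_of_mem (by exact hk2)]
        rw [← neg_sub 1 θ, ENNReal.rpow_neg, ENNReal.rpow_neg, ENNReal.inv_le_inv]
        exact ENNReal.rpow_le_rpow hk1 (by linarith)
    _ = ∑' k : ℕ, (M * 2⁻¹ ^ (k + 1)) ^ (θ - 1) *
          μ.restrict (Ioo 0 s) {t | μ (Ioo 0 t) ≤ M * 2⁻¹ ^ k} := by
        rw [lintegral_tsum fun k => (measurable_const.indicator (hmeas k)).aemeasurable]
        simp_rw [lintegral_indicator_const (hmeas _)]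
    _ ≤ ∑' k : ℕ, (M * 2⁻¹ ^ (k + 1)) ^ (θ - 1) * (M * 2⁻¹ ^ k) := by
        gcongr with k
        rw [Measure.restrict_apply (hmeas k)]
        rw [inter_comm]
        exact measure_setOf_measure_Ioo_le μ s _
    _ = 2⁻¹ ^ (θ - 1) * (1 - 2⁻¹ ^ θ)⁻¹ * M ^ θ := by
        simp_rw [hterm]
        rw [ENNReal.tsum_mul_left, ENNReal.tsum_geometric]
        ring

/-- Tonelli's theorem on the triangle `0 < t < s`. -/
lemma lintegral_Ioi_mul_lintegral_Ioi_eq {g h : ℝ → ℝ≥0∞} (hg : Measurable g)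
    (hh : Measurable h) :
    ∫⁻ t in Ioi (0 : ℝ), (∫⁻ s in Ioi t, g s) * h t =
      ∫⁻ s in Ioi (0 : ℝ), g s * ∫⁻ t in Ioo 0 s, h t := by
  have hT : MeasurableSet {x : ℝ × ℝ | 0 < x.1 ∧ x.1 < x.2} :=
    (measurableSet_lt measurable_const measurable_fst).inter
      (measurableSet_lt measurable_fst measurable_snd)
  set F : ℝ → ℝ → ℝ≥0∞ := fun t s =>
    {x : ℝ × ℝ | 0 < x.1 ∧ x.1 < x.2}.indicator (fun x => g x.2 * h x.1) (t, s) with hF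
  have hFm : Measurable (Function.uncurry F) :=
    ((hg.comp measurable_snd).mul (hh.comp measurable_fst)).indicator hT
  have hl : ∫⁻ t in Ioi (0 : ℝ), (∫⁻ s in Ioi t, g s) * h t = ∫⁻ t, ∫⁻ s, F t s := by
    rw [← lintegral_indicator measurableSet_Ioi]
    refine lintegral_congr fun t => ?_
    by_cases ht : 0 < t
    · rw [indicator_of_mem (mem_Ioi.2 ht), ← lintegral_mul_const _ hg,
        ← lintegral_indicator measurableSet_Ioi]
      refine lintegral_congr fun s => ?_
      simp [hF, indicator_apply, ht]
    · simp [hF, indicator_apply, ht]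
  have hr : ∫⁻ s in Ioi (0 : ℝ), g s * ∫⁻ t in Ioo 0 s, h t = ∫⁻ s, ∫⁻ t, F t s := by
    rw [← lintegral_indicator measurableSet_Ioi]
    refine lintegral_congr fun s => ?_
    by_cases hs : 0 < s
    · rw [indicator_of_mem (mem_Ioi.2 hs), ← lintegral_const_mul _ hh,
        ← lintegral_indicator measurableSet_Ioo]
      refine lintegral_congr fun t => ?_
      simp [hF, indicator_apply]
    · have : ∀ t : ℝ, ¬ (0 < t ∧ t < s) := fun t ht => hs (ht.1.trans ht.2)
      simp [hF, indicator_apply, hs, this]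
  rw [hl, hr, lintegral_lintegral_swap hFm.aemeasurable]

/-- Test function, upper bound (necessity for `p > q`, `p > 1`): with
`r = pq/(p-q)`, `θ > r/p'`, `B = ∫_0^∞ V^r W^{r/p} w` and
`f(t) = (∫_t^∞ W^{r/p} w V^{r-θp'})^{1/p} V(t)^{(θ-1)(p'-1)} v(t)^{1-p'}`,
one has `∫_0^∞ f^p v ≤ c·B`, where `c` depends only on `p`, `q` and `θ`. -/
theorem hardy_test_function_upper_bound (p q r p' θ : ℝ) (hp : 1 < p)
    (hq : 0 < q) (hqp : q < p) (hr : r = p * q / (p - q)) (hp' : p' = p / (p - 1))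
    (hθ : r / p' < θ) :
    ∃ c : ℝ, 0 < c ∧
      ∀ (v w V W f : ℝ → ℝ≥0∞) (B : ℝ≥0∞),
        Measurable v → Measurable w →
        (∀ s : ℝ, V s = (∫⁻ u in Ioo 0 s, v u ^ (1 - p')) ^ (1 / p')) →
        (∀ s : ℝ, W s = ∫⁻ u in Ioi s, w u) →
        (∀ t : ℝ, f t =
          (∫⁻ s in Ioi t, W s ^ (r / p) * w s * V s ^ (r - θ * p')) ^ (1 / p) *
            V t ^ ((θ - 1) * (p' - 1)) * v t ^ (1 - p')) →
        B = (∫⁻ t in Ioi (0 : ℝ), V t ^ r * W t ^ (r / p) * w t) →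
        ∫⁻ t in Ioi (0 : ℝ), f t ^ p * v t ≤ ENNReal.ofReal c * B := by
  have hp0 : 0 < p := by linarith
  have hp1 : 0 < p - 1 := by linarith
  have hp'0 : 0 < p' := by rw [hp']; positivity
  have hr0 : 0 < r := by rw [hr]; exact div_pos (by positivity) (by linarith)
  have hθ0 : 0 < θ := lt_trans (by positivity) hθ
  have hrθ : r - θ * p' < 0 := by rw [div_lt_iff₀ hp'0] at hθ; linarith
  have hconj : (p' - 1) * p = p' := by rw [hp']; field_simp; ring
  obtain ⟨C, hC, hbound⟩ := exists_lintegral_measure_Ioo_rpow_le θ hθ0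
  refine ⟨C.toReal + 1, by positivity, ?_⟩
  intro v w V W f B hv hw hV hW hf hB
  set σ : ℝ → ℝ≥0∞ := fun u => v u ^ (1 - p') with hσ
  have hσm : Measurable σ := hv.pow_const _
  set μ : Measure ℝ := volume.withDensity σ with hμ
  have hμU (s : ℝ) : μ (Ioo 0 s) = ∫⁻ u in Ioo 0 s, σ u := withDensity_apply _ measurableSet_Ioo
  have hVμ (s : ℝ) : V s = μ (Ioo 0 s) ^ (1 / p') := by rw [hV, hμU]
  have hμV (s : ℝ) : μ (Ioo 0 s) = V s ^ p' := by
    rw [hVμ, ← ENNReal.rpow_mul, one_div_mul_cancel hp'0.ne', ENNReal.rpow_one]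
  have hVm : Measurable V := by
    rw [funext hVμ]; exact (measurable_measure_Ioo μ).pow_const _
  have hWm : Measurable W := by
    rw [funext hW]
    exact Antitone.measurable fun a b hab => lintegral_mono_set (Ioi_subset_Ioi hab)
  set g : ℝ → ℝ≥0∞ := fun s => W s ^ (r / p) * w s * V s ^ (r - θ * p') with hg
  have hgm : Measurable g := ((hWm.pow_const _).mul hw).mul (hVm.pow_const _)
  set h : ℝ → ℝ≥0∞ := fun t => μ (Ioo 0 t) ^ (θ - 1) * σ t with hh
  have hhm : Measurable h := ((measurable_measure_Ioo μ).pow_const _).mul hσm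
  have hvσ (t : ℝ) : (v t ^ (1 - p')) ^ p * v t ≤ σ t := by
    rw [← ENNReal.rpow_mul]
    by_cases h0 : v t = 0
    · simp [h0]
    by_cases ht : v t = ⊤
    · have : (1 - p') * p < 0 := by linarith
      simp [ht, ENNReal.top_rpow_of_neg this]
    nth_rewrite 2 [← ENNReal.rpow_one (v t)]
    rw [← ENNReal.rpow_add _ _ h0 ht]
    exact le_of_eq (congrArg _ (by linarith))
  have hfh (t : ℝ) : f t ^ p * v t ≤ (∫⁻ s in Ioi t, g s) * h t := by
    have hexp : (θ - 1) * (p' - 1) * p = p' * (θ - 1) := by rw [mul_assoc, hconj, mul_comm]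
    rw [hf, ENNReal.mul_rpow_of_nonneg _ _ hp0.le, ENNReal.mul_rpow_of_nonneg _ _ hp0.le,
      ← ENNReal.rpow_mul, ← ENNReal.rpow_mul (V t), one_div_mul_cancel hp0.ne', ENNReal.rpow_one,
      hexp, ENNReal.rpow_mul, ← hμV, mul_assoc, mul_assoc]
    gcongr
    exact mul_le_mul' le_rfl (hvσ t)
  have hinner (s : ℝ) : ∫⁻ t in Ioo 0 s, h t = ∫⁻ t in Ioo 0 s, μ (Ioo 0 t) ^ (θ - 1) ∂μ := by
    nth_rewrite 2 [hμ]
    rw [restrict_withDensity measurableSet_Ioo, lintegral_withDensity_eq_lintegral_mul _ hσm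
      ((measurable_measure_Ioo μ).pow_const _)]
    simp [hh, mul_comm]
  have hpt (s : ℝ) : g s * ∫⁻ t in Ioo 0 s, h t ≤ C * (V s ^ r * W s ^ (r / p) * w s) := by
    by_cases htop : V s = ⊤
    · simp [hg, htop, ENNReal.top_rpow_of_neg hrθ]
    have hfin : μ (Ioo 0 s) ≠ ⊤ := by
      rw [hμV]; exact ENNReal.rpow_ne_top_of_nonneg hp'0.le htop
    have hVpow : V s ^ (r - θ * p') * V s ^ (p' * θ) ≤ V s ^ r := by
      by_cases h0 : V s = 0
      · simp [h0, ENNReal.zero_rpow_of_pos (mul_pos hp'0 hθ0)]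
      rw [← ENNReal.rpow_add _ _ h0 htop]
      exact le_of_eq (congrArg _ (by ring))
    have := hbound μ s hfin
    rw [← hinner] at this
    calc g s * ∫⁻ t in Ioo 0 s, h t ≤ g s * (C * μ (Ioo 0 s) ^ θ) := by gcongr
      _ = C * (V s ^ (r - θ * p') * V s ^ (p' * θ) * W s ^ (r / p) * w s) := by
          rw [hμV, ← ENNReal.rpow_mul]; simp only [hg]; ring
      _ ≤ C * (V s ^ r * W s ^ (r / p) * w s) := by gcongr
  calc ∫⁻ t in Ioi (0 : ℝ), f t ^ p * v t
      ≤ ∫⁻ t in Ioi (0 : ℝ), (∫⁻ s in Ioi t, g s) * h t := lintegral_mono fun t => hfh t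
    _ = ∫⁻ s in Ioi (0 : ℝ), g s * ∫⁻ t in Ioo 0 s, h t :=
        lintegral_Ioi_mul_lintegral_Ioi_eq hgm hhm
    _ ≤ ∫⁻ s in Ioi (0 : ℝ), C * (V s ^ r * W s ^ (r / p) * w s) := lintegral_mono hpt
    _ = C * B := by rw [lintegral_const_mul' _ _ hC, hB]
    _ ≤ ENNReal.ofReal (C.toReal + 1) * B := by
        gcongr
        exact (ENNReal.le_ofReal_iff_toReal_le hC (by positivity)).2 (by linarith)
end
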